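/- arXiv:2507.06027 — 2 statements merged into one kernel-verified Lean document; each statement's English description precedes it below -/
import Mathlib

section
/- If v is a solution of problem (1.4) with wave speed c, with associated continuous function Φ, then the function y(ξ) := −Φ(v⁻¹(ξ)) for ξ ∈ (0,1) (well-defined because v is strictly decreasing on I_v := {z : 0 < v(z) < 1}) is continuous on (0,1), continuously differentiable on (0,1) \ Θ, and is a solution of the first-order problem (3.1) with the same speed c. -/
open Filter Set MeasureTheory Topology

/-- A traveling-wave solution (solution of problem (1.4)) with speed `c`,
together with its associated continuous function `Φ`. -/
def IsTWSol (p : ℝ) (Θ : Set ℝ) (f g h d : ℝ → ℝ) (c : ℝ) (v Φ : ℝ → ℝ) : Prop :=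
  Continuous v ∧ (∀ z, v z ∈ Set.Icc (0:ℝ) 1) ∧
  Filter.Tendsto v Filter.atBot (nhds 1) ∧
  Filter.Tendsto v Filter.atTop (nhds 0) ∧
  ContDiffOn ℝ 1 v {z : ℝ | v z ∉ Θ ∪ ({0, 1} : Set ℝ)} ∧
  Continuous Φ ∧
  (∀ a b : ℝ, a < b → ContDiffOn ℝ 1 v (Set.Ioo a b) →
    (∀ z ∈ Set.Ioo a b, v z ∈ Set.Ioo (0:ℝ) 1) →
    ∀ z ∈ Set.Ioo a b, Φ z = d (v z) * |deriv v z| ^ (p - 2) * deriv v z) ∧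
  Filter.Tendsto Φ Filter.atBot (nhds 0) ∧
  Filter.Tendsto Φ Filter.atTop (nhds 0) ∧
  (∀ z, (v z = 0 ∨ v z = 1) → Φ z = 0) ∧
  (∀ z₁ z₂ : ℝ,
    Φ z₂ - Φ z₁ + (∫ ξ in (v z₁)..(v z₂), (c * g ξ - f ξ)) + (∫ z in z₁..z₂, h (v z)) = 0)

/-- A solution of the first-order singular problem (3.1) with speed `c`. -/
def IsFOSol (p : ℝ) (Θ : Set ℝ) (f g κ : ℝ → ℝ) (c : ℝ) (y : ℝ → ℝ) : Prop :=
  ContinuousOn y (Set.Ioo 0 1) ∧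
  ContDiffOn ℝ 1 y (Set.Ioo 0 1 \ Θ) ∧
  (∀ ξ ∈ Set.Ioo (0:ℝ) 1, 0 < y ξ) ∧
  Filter.Tendsto y (nhdsWithin 0 (Set.Ioi 0)) (nhds 0) ∧
  Filter.Tendsto y (nhdsWithin 1 (Set.Iio 1)) (nhds 0) ∧
  (∀ ξ ∈ Set.Ioo (0:ℝ) 1 \ Θ,
    HasDerivAt y (c * g ξ - f ξ - κ ξ / (y ξ) ^ ((1:ℝ)/(p-1))) ξ)

lemma measurable_indicator_of_continuous_off_finite {Θ s : Set ℝ} (hΘ : Θ.Finite)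
    (hs : MeasurableSet s) {F : ℝ → ℝ}
    (hF : ∀ x ∈ s \ Θ, ContinuousWithinAt F s x) : Measurable (s.indicator F) := by
  classical
  have h1 : Measurable ((s \ Θ).indicator F) := by
    rw [← piecewise_eq_indicator]
    refine ContinuousOn.measurable_piecewise (fun x hx => (hF x hx).mono sdiff_subset)
      continuousOn_const (hs.diff hΘ.measurableSet)
  refine h1.measurable_of_countable_ne (hΘ.countable.mono ?_)
  intro x hx
  by_contra hxΘ
  apply hx
  by_cases hxs : x ∈ s
  · rw [indicator_of_mem hxs, indicator_of_mem (mem_sdiff_of_mem hxs hxΘ)]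
  · rw [indicator_of_notMem hxs, indicator_of_notMem fun h => hxs h.1]

lemma measurable_comp_of_continuous_off_finite {Θ s : Set ℝ} (hΘ : Θ.Finite)
    (hs : MeasurableSet s) {F u : ℝ → ℝ}
    (hF : ∀ x ∈ s \ Θ, ContinuousWithinAt F s x) (hu : Continuous u) (hus : ∀ z, u z ∈ s) :
    Measurable fun z => F (u z) := by
  have : (fun z => F (u z)) = s.indicator F ∘ u := by
    ext z
    simp [indicator_of_mem (hus z)]
  rw [this]
  exact (measurable_indicator_of_continuous_off_finite hΘ hs hF).comp hu.measurable

lemma intervalIntegrable_of_measurable_of_abs_le {F : ℝ → ℝ} (hF : Measurable F) {M : ℝ}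
    (hM : ∀ z, |F z| ≤ M) (a b : ℝ) : IntervalIntegrable F volume a b :=
  (intervalIntegrable_const (c := M)).mono_fun hF.aestronglyMeasurable
    (Eventually.of_forall fun z => (hM z).trans (le_abs_self M))

lemma pos_of_locally_bounded_below {h : ℝ → ℝ}
    (hpos : ∀ a b : ℝ, 0 < a → a < b → b < 1 → ∃ m > 0, ∀ x ∈ Icc a b, m ≤ h x)
    {ξ : ℝ} (hξ : ξ ∈ Ioo (0:ℝ) 1) : ∃ m > 0, ∀ᶠ x in 𝓝 ξ, m ≤ h x := by
  obtain ⟨h0, h1⟩ := hξ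
  obtain ⟨m, hm, hmh⟩ := hpos (ξ / 2) ((1 + ξ) / 2) (by linarith) (by linarith) (by linarith)
  exact ⟨m, hm, eventually_of_mem (Icc_mem_nhds (by linarith) (by linarith)) hmh⟩

lemma integral_pos_of_pos_left {F : ℝ → ℝ} {a b : ℝ} (hab : a < b)
    (hF : IntervalIntegrable F volume a b) (hnn : ∀ z, 0 ≤ F z) (hpos : ∀ᶠ z in 𝓝 a, 0 < F z) :
    0 < ∫ z in a..b, F z := by
  rw [intervalIntegral.integral_pos_iff_support_of_nonneg_ae (Eventually.of_forall hnn) hF]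
  refine ⟨hab, ?_⟩
  obtain ⟨e, he, heF⟩ := (mem_nhdsGE_iff_exists_Icc_subset (a := a)).1
    (mem_nhdsWithin_of_mem_nhds hpos)
  have he' : a < e := he
  calc (0 : ENNReal) < volume (Ioo a (min e b)) := by simp [he', hab]
    _ ≤ _ := measure_mono fun z hz => by
      have hz2 := lt_min_iff.1 hz.2
      exact ⟨(heF ⟨hz.1.le, hz2.1.le⟩ : 0 < F z).ne', hz.1, hz2.2.le⟩

lemma HasDerivAt.nonneg_of_eventually_le_left {u : ℝ → ℝ} {u' z : ℝ} (hu : HasDerivAt u u' z)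
    (hle : ∀ᶠ x in 𝓝[<] z, u x ≤ u z) : 0 ≤ u' := by
  refine ge_of_tendsto (hasDerivAt_iff_tendsto_slope_left_right.1 hu).1 ?_
  filter_upwards [hle, self_mem_nhdsWithin] with x hx hxz
  rw [slope_def_field]
  exact div_nonneg_of_nonpos (by linarith) (sub_nonpos.2 (le_of_lt hxz))

lemma HasDerivAt.nonpos_of_eventually_le_right {u : ℝ → ℝ} {u' z : ℝ} (hu : HasDerivAt u u' z)
    (hle : ∀ᶠ x in 𝓝[>] z, u x ≤ u z) : u' ≤ 0 := by
  refine le_of_tendsto (hasDerivAt_iff_tendsto_slope_left_right.1 hu).2 ?_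
  filter_upwards [hle, self_mem_nhdsWithin] with x hx hxz
  rw [slope_def_field]
  exact div_nonpos_of_nonpos_of_nonneg (by linarith) (sub_nonneg.2 (le_of_lt hxz))

lemma exists_first_ge {u : ℝ → ℝ} (hu : Continuous u) {a b ξ : ℝ} (hab : a ≤ b)
    (ha : u a < ξ) (hb : ξ ≤ u b) : ∃ z ∈ Ioc a b, u z = ξ ∧ ∀ x ∈ Ico a z, u x < ξ := by
  have hne : (Icc a b ∩ u ⁻¹' Ici ξ).Nonempty := ⟨b, ⟨hab, le_rfl⟩, hb⟩
  have hcomp : IsCompact (Icc a b ∩ u ⁻¹' Ici ξ) :=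
    isCompact_Icc.inter_right (isClosed_Ici.preimage hu)
  obtain ⟨z, ⟨hz, hzξ⟩, hmin⟩ := hcomp.exists_isLeast hne
  have hlt : ∀ x ∈ Ico a z, u x < ξ := fun x hx => by
    by_contra! hcon
    exact absurd (hmin ⟨⟨hx.1, hx.2.le.trans hz.2⟩, hcon⟩) (not_le.2 hx.2)
  have haz : a < z := lt_of_le_of_ne hz.1 (by rintro rfl; exact absurd ha (not_lt.2 hzξ))
  refine ⟨z, ⟨haz, hz.2⟩, le_antisymm ?_ hzξ, hlt⟩
  refine le_of_tendsto (hu.tendsto z |>.mono_left (nhdsWithin_le_nhds (s := Iio z))) ?_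
  filter_upwards [Ioo_mem_nhdsLT haz] with x hx using (hlt x ⟨hx.1.le, hx.2⟩).le

lemma exists_last_ge {u : ℝ → ℝ} (hu : Continuous u) {a b ξ : ℝ} (hab : a ≤ b)
    (ha : ξ ≤ u a) (hb : u b < ξ) : ∃ z ∈ Ico a b, u z = ξ ∧ ∀ x ∈ Ioc z b, u x < ξ := by
  obtain ⟨z, hz, hzξ, hlt⟩ := exists_first_ge (u := fun x => u (-x)) (hu.comp continuous_neg)
    (neg_le_neg hab) (by simpa using hb) (by simpa using ha)
  refine ⟨-z, ⟨by linarith [hz.2], by linarith [hz.1]⟩, hzξ, fun x hx => ?_⟩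
  simpa using hlt (-x) ⟨by linarith [hx.2], by linarith [hx.1]⟩

lemma rpow_sub_two_mul_self {p x : ℝ} (hp : 1 < p) (hx : 0 ≤ x) :
    x ^ (p - 2) * x = x ^ (p - 1) := by
  rcases hx.eq_or_lt with rfl | hx
  · rw [mul_zero, Real.zero_rpow (by linarith)]
  · rw [← Real.rpow_add_one hx.ne']
    ring_nf

namespace IsTWSol

variable {p : ℝ} {Θ : Set ℝ} {f g h d : ℝ → ℝ} {c : ℝ} {v Φ : ℝ → ℝ}

lemma mem_Ioo_of_notMem (hsol : IsTWSol p Θ f g h d c v Φ) {z : ℝ}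
    (hz : v z ∉ Θ ∪ ({0, 1} : Set ℝ)) : v z ∈ Ioo (0:ℝ) 1 := by
  simp only [mem_union, mem_insert_iff, mem_singleton_iff, not_or] at hz
  have := hsol.2.1 z
  exact ⟨lt_of_le_of_ne this.1 (Ne.symm hz.2.1), lt_of_le_of_ne this.2 hz.2.2⟩

lemma hasDerivAt_and_flux_eq (hsol : IsTWSol p Θ f g h d c v Φ) (hΘ : Θ.Finite) {z : ℝ}
    (hz : v z ∉ Θ ∪ ({0, 1} : Set ℝ)) :
    HasDerivAt v (deriv v z) z ∧ Φ z = d (v z) * |deriv v z| ^ (p - 2) * deriv v z := by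
  obtain ⟨hv, -, -, -, hC1, -, hlaw, -⟩ := id hsol
  have hopen : IsOpen {z : ℝ | v z ∉ Θ ∪ ({0, 1} : Set ℝ)} :=
    ((hΘ.union (toFinite {0, 1})).isClosed.isOpen_compl).preimage hv
  have hmem := hopen.mem_nhds hz
  obtain ⟨a, b, hab, hsub⟩ := mem_nhds_iff_exists_Ioo_subset.1 hmem
  refine ⟨((hC1.differentiableOn one_ne_zero).differentiableAt hmem).hasDerivAt, ?_⟩
  exact hlaw a b (hab.1.trans hab.2) (hC1.mono hsub)
    (fun x hx => hsol.mem_Ioo_of_notMem (hsub hx)) z hab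

lemma antitone (hsol : IsTWSol p Θ f g h d c v Φ) (hΘ : Θ.Finite)
    (hint : ∀ a b : ℝ, IntervalIntegrable (fun z => h (v z)) volume a b)
    (hnn : ∀ z, 0 ≤ h (v z)) (hpos : ∀ ξ ∈ Ioo (0:ℝ) 1, ∀ᶠ x in 𝓝 ξ, 0 < h x)
    (hd : ∀ ξ ∈ Ioo (0:ℝ) 1, 0 < d ξ) : Antitone v := by
  obtain ⟨hv, hv01, hbot, -, -, -, -, -, -, -, heq⟩ := id hsol
  intro a b hab
  by_contra! hlt
  obtain ⟨ξ, ⟨haξ, hξb⟩, hξΘ⟩ := ((Ioo_infinite hlt).sdiff hΘ).nonempty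
  have hξ : ξ ∈ Ioo (0:ℝ) 1 := ⟨(hv01 a).1.trans_lt haξ, hξb.trans_le (hv01 b).2⟩
  have hgen : ξ ∉ Θ ∪ ({0, 1} : Set ℝ) := by
    simp [hξΘ, hξ.1.ne', hξ.2.ne]
  obtain ⟨a', ha', haa⟩ := ((hbot.eventually_const_le hξ.2).and (eventually_le_atBot a)).exists
  obtain ⟨z₁, hz₁, hvz₁, hlt₁⟩ := exists_last_ge hv haa ha' haξ
  obtain ⟨z₂, hz₂, hvz₂, hlt₂⟩ := exists_first_ge hv hab haξ hξb.le
  obtain ⟨hd₁, hΦ₁⟩ := hsol.hasDerivAt_and_flux_eq hΘ (z := z₁) (hvz₁ ▸ hgen)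
  obtain ⟨hd₂, hΦ₂⟩ := hsol.hasDerivAt_and_flux_eq hΘ (z := z₂) (hvz₂ ▸ hgen)
  have h₁ : deriv v z₁ ≤ 0 := hd₁.nonpos_of_eventually_le_right <| by
    filter_upwards [Ioc_mem_nhdsGT hz₁.2] with x hx using hvz₁ ▸ (hlt₁ x hx).le
  have h₂ : 0 ≤ deriv v z₂ := hd₂.nonneg_of_eventually_le_left <| by
    filter_upwards [Ico_mem_nhdsLT hz₂.1] with x hx using hvz₂ ▸ (hlt₂ x hx).le
  have hdξ := hd ξ hξ
  have hΦ₁' : Φ z₁ ≤ 0 := by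
    rw [hΦ₁, hvz₁]
    exact mul_nonpos_of_nonneg_of_nonpos (by positivity) h₁
  have hΦ₂' : 0 ≤ Φ z₂ := by
    rw [hΦ₂, hvz₂]
    positivity
  have hI := integral_pos_of_pos_left (hz₁.2.trans hz₂.1) (hint z₁ z₂) hnn
    (hv.continuousAt.eventually (hvz₁ ▸ hpos ξ hξ))
  have := heq z₁ z₂
  rw [hvz₁, hvz₂, intervalIntegral.integral_same] at this
  linarith

lemma lt_of_lt (hsol : IsTWSol p Θ f g h d c v Φ) (hanti : Antitone v)
    (hint : ∀ a b : ℝ, IntervalIntegrable (fun z => h (v z)) volume a b)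
    (hnn : ∀ z, 0 ≤ h (v z)) (hpos : ∀ ξ ∈ Ioo (0:ℝ) 1, ∀ᶠ x in 𝓝 ξ, 0 < h x)
    {a b : ℝ} (hab : a < b) (hva : v a ∈ Ioo (0:ℝ) 1) : v b < v a := by
  obtain ⟨hv, -, -, -, -, -, hlaw, -, -, -, heq⟩ := id hsol
  refine lt_of_le_of_ne (hanti hab.le) fun hvab => ?_
  have hconst : ∀ z ∈ Ioo a b, v z = v a := fun z hz =>
    le_antisymm (hanti hz.1.le) (hvab ▸ hanti hz.2.le)
  have hΦ : ∀ z ∈ Ioo a b, Φ z = 0 := fun z hz => by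
    have hderiv : deriv v z = 0 := by
      have hev : v =ᶠ[𝓝 z] fun _ => v a := eventually_of_mem (Ioo_mem_nhds hz.1 hz.2) hconst
      rw [hev.deriv_eq, deriv_const]
    rw [hlaw a b hab (contDiffOn_const.congr hconst) (fun x hx => (hconst x hx).symm ▸ hva) z hz,
      hderiv, mul_zero]
  obtain ⟨s, has, hsb⟩ := exists_between hab
  obtain ⟨t, hst, htb⟩ := exists_between hsb
  have hs : s ∈ Ioo a b := ⟨has, hsb⟩
  have ht : t ∈ Ioo a b := ⟨has.trans hst, htb⟩
  have hI := integral_pos_of_pos_left hst (hint s t) hnn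
    (hv.continuousAt.eventually ((hconst s hs).symm ▸ hpos _ hva))
  have := heq s t
  rw [hΦ s hs, hΦ t ht, hconst s hs, hconst t ht, intervalIntegral.integral_same] at this
  linarith

lemma flux_nonpos (hsol : IsTWSol p Θ f g h d c v Φ) (hΘ : Θ.Finite) (hanti : Antitone v)
    (hd : ∀ ξ ∈ Ioo (0:ℝ) 1, 0 < d ξ) {z : ℝ} (hz : v z ∉ Θ ∪ ({0, 1} : Set ℝ)) :
    Φ z ≤ 0 := by
  obtain ⟨hd₁, hΦ₁⟩ := hsol.hasDerivAt_and_flux_eq hΘ hz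
  have h₁ : deriv v z ≤ 0 := hd₁.nonpos_of_eventually_le_right <|
    eventually_mem_nhdsWithin.mono fun x hx => hanti (le_of_lt hx)
  have := hd _ (hsol.mem_Ioo_of_notMem hz)
  rw [hΦ₁]
  exact mul_nonpos_of_nonneg_of_nonpos (by positivity) h₁

/-- To the left of a point where the flux vanishes, the derivative of the profile tends to zero. -/
lemma tendsto_deriv_of_flux_eq_zero (hp : 1 < p) (hsol : IsTWSol p Θ f g h d c v Φ)
    (hΘ : Θ.Finite) {z : ℝ} (hd : ∃ m > 0, ∀ᶠ x in 𝓝 (v z), m ≤ d x)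
    (hgen : ∀ᶠ x in 𝓝[<] z, v x ∉ Θ ∪ ({0, 1} : Set ℝ)) (hz : Φ z = 0) :
    Tendsto (deriv v) (𝓝[<] z) (𝓝 0) := by
  obtain ⟨hv, -, -, -, -, hΦ, -⟩ := id hsol
  obtain ⟨m, hm, hmd⟩ := hd
  have hp1 : 0 < p - 1 := by linarith
  have hlim : Tendsto (fun x => (|Φ x| / m) ^ (p - 1)⁻¹) (𝓝[<] z) (𝓝 0) := by
    have h1 : Tendsto (fun x => |Φ x| / m) (𝓝 z) (𝓝 0) := by
      simpa [hz] using (hΦ.abs.div_const m).tendsto z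
    simpa [Real.zero_rpow (inv_pos.2 hp1).ne'] using
      (h1.mono_left nhdsWithin_le_nhds).rpow_const (Or.inr (inv_pos.2 hp1).le)
  refine squeeze_zero_norm' ?_ hlim
  filter_upwards [hgen, nhdsWithin_le_nhds (hv.continuousAt.eventually hmd)] with x hx hmx
  obtain ⟨-, hΦx⟩ := hsol.hasDerivAt_and_flux_eq hΘ hx
  have habs : |Φ x| = d (v x) * |deriv v x| ^ (p - 1) := by
    rw [hΦx, abs_mul, abs_of_nonneg (a := d (v x) * _)
      (mul_nonneg (hm.le.trans hmx) (by positivity)), mul_assoc,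
      rpow_sub_two_mul_self hp (abs_nonneg _)]
  rw [Real.norm_eq_abs, Real.le_rpow_inv_iff_of_pos (abs_nonneg _) (by positivity) hp1,
    le_div_iff₀ hm, habs, mul_comm]
  gcongr

lemma flux_neg (hp : 1 < p) (hsol : IsTWSol p Θ f g h d c v Φ) (hΘ : Θ.Finite)
    (hanti : Antitone v) (hlt : ∀ a b : ℝ, a < b → v a ∈ Ioo (0:ℝ) 1 → v b < v a)
    (hint : ∀ a b : ℝ, IntervalIntegrable (fun z => h (v z)) volume a b)
    (hpos : ∀ ξ ∈ Ioo (0:ℝ) 1, ∃ m > 0, ∀ᶠ x in 𝓝 ξ, m ≤ h x)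
    (hd : ∀ ξ ∈ Ioo (0:ℝ) 1, ∃ m > 0, ∀ᶠ x in 𝓝 ξ, m ≤ d x)
    {M : ℝ} (hM : ∀ ξ ∈ Icc (0:ℝ) 1, |c * g ξ - f ξ| ≤ M)
    {z : ℝ} (hz : v z ∈ Ioo (0:ℝ) 1) : Φ z < 0 := by
  obtain ⟨hv, hv01, -, -, -, hΦ, -, -, -, -, heq⟩ := id hsol
  have hd0 : ∀ ξ ∈ Ioo (0:ℝ) 1, 0 < d ξ := fun ξ hξ => by
    obtain ⟨m, hm, hmd⟩ := hd ξ hξ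
    exact hm.trans_le hmd.self_of_nhds
  have hgen : ∀ᶠ x in 𝓝[<] z, v x ∉ Θ ∪ ({0, 1} : Set ℝ) := by
    have hfin : ((Θ ∪ ({0, 1} : Set ℝ)) \ {v z}).Finite :=
      (hΘ.union (toFinite {0, 1})).subset sdiff_subset
    have h1 : ∀ᶠ x in 𝓝 z, v x ∈ ((Θ ∪ ({0, 1} : Set ℝ)) \ {v z})ᶜ :=
      hv.continuousAt.eventually (hfin.isClosed.isOpen_compl.mem_nhds (by simp))
    filter_upwards [nhdsWithin_le_nhds h1, self_mem_nhdsWithin] with x hx hxz hxΘ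
    exact hx ⟨hxΘ, fun hxz' : v x = v z => (hlt x z hxz (hxz' ▸ hz)).ne hxz'.symm⟩
  have hnonpos : Φ z ≤ 0 :=
    le_of_tendsto ((hΦ.tendsto z).mono_left nhdsWithin_le_nhds)
      (hgen.mono fun x hx => hsol.flux_nonpos hΘ hanti hd0 hx)
  refine lt_of_le_of_ne hnonpos fun hΦz => ?_
  have hderiv : HasDerivWithinAt v 0 (Iic z) z :=
    hasDerivWithinAt_Iic_of_tendsto_deriv
      (s := {x | v x ∉ Θ ∪ ({0, 1} : Set ℝ)})
      (fun x hx => (hsol.hasDerivAt_and_flux_eq hΘ hx).1.differentiableAt.differentiableWithinAt)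
      hv.continuousWithinAt hgen
      (hsol.tendsto_deriv_of_flux_eq_zero hp hΘ (hd _ hz) hgen hΦz)
  obtain ⟨m, hm, hmh⟩ := hpos _ hz
  have hM0 : 0 ≤ M := (abs_nonneg _).trans (hM 0 (by simp))
  have hε : 0 < m / (2 * (M + 1)) := by positivity
  obtain ⟨l, hlz, hl⟩ := mem_nhdsLE_iff_exists_Ioc_subset.1
    (mem_nhdsWithin_of_mem_nhds (hv.continuousAt.eventually hmh))
  obtain ⟨x, hxgen, hxO, hlx, hxz⟩ := (hgen.and (((hderiv.isLittleO.def hε).filter_mono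
    (nhdsWithin_mono z Iio_subset_Iic_self)).and
    (Ioo_mem_nhdsLT (show l < z from hlz)))).exists
  have hΦx := hsol.flux_nonpos hΘ hanti hd0 hxgen
  simp only [smul_eq_mul, mul_zero, sub_zero, Real.norm_eq_abs] at hxO
  have hF : |∫ ξ in (v x)..(v z), (c * g ξ - f ξ)| ≤ M * |v z - v x| := by
    rw [← Real.norm_eq_abs]
    exact intervalIntegral.norm_integral_le_of_norm_le_const fun ξ hξ => hM ξ
      ((ordConnected_Icc.uIcc_subset (hv01 x) (hv01 z)) (uIoc_subset_uIcc hξ))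
  have hI : m * (z - x) ≤ ∫ s in x..z, h (v s) := by
    have := intervalIntegral.integral_mono_on hxz.le (intervalIntegrable_const (c := m))
      (hint x z) (fun s hs => hl ⟨hlx.trans_le hs.1, hs.2⟩)
    simpa [mul_comm] using this
  have hxz' : |x - z| = z - x := by rw [abs_sub_comm, abs_of_pos (sub_pos.2 hxz)]
  rw [hxz', abs_sub_comm] at hxO
  have hsmall : M * |v z - v x| < m * (z - x) := by
    calc M * |v z - v x| ≤ M * (m / (2 * (M + 1)) * (z - x)) := by gcongr
      _ = M / (2 * (M + 1)) * (m * (z - x)) := by ring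
      _ < 1 * (m * (z - x)) := by
        refine mul_lt_mul_of_pos_right ?_ (mul_pos hm (sub_pos.2 hxz))
        rw [div_lt_one (by positivity)]
        linarith
      _ = m * (z - x) := one_mul _
  have := heq x z
  linarith [neg_le_of_abs_le hF]

end IsTWSol

lemma flux_comp_tendsto_zero {v Φ w : ℝ → ℝ} {l : Filter ℝ} (hv : Continuous v)
    (hΦ : Continuous Φ) (hbot : Tendsto Φ atBot (𝓝 0)) (htop : Tendsto Φ atTop (𝓝 0)) {e : ℝ}
    (he : ∀ z, v z = e → Φ z = 0) (hw : Tendsto (fun ξ => v (w ξ)) l (𝓝 e)) :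
    Tendsto (fun ξ => Φ (w ξ)) l (𝓝 0) := by
  rw [Metric.tendsto_nhds]
  intro ε hε
  have hcocompact : ∀ᶠ z in cocompact ℝ, dist (Φ z) 0 < ε := by
    rw [cocompact_eq_atBot_atTop]
    exact eventually_sup.2 ⟨Metric.tendsto_nhds.1 hbot ε hε, Metric.tendsto_nhds.1 htop ε hε⟩
  obtain ⟨K, hK, hKε⟩ := mem_cocompact.1 hcocompact
  have hL : IsCompact (K ∩ {z | ε ≤ dist (Φ z) 0}) :=
    hK.inter_right (isClosed_le continuous_const (hΦ.dist continuous_const))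
  have hmem : (v '' (K ∩ {z | ε ≤ dist (Φ z) 0}))ᶜ ∈ 𝓝 e := by
    refine (hL.image hv).isClosed.isOpen_compl.mem_nhds ?_
    rintro ⟨z, ⟨-, hz⟩, hze⟩
    have hz' : ε ≤ dist (Φ z) 0 := hz
    rw [he z hze, dist_self] at hz'
    linarith
  filter_upwards [hw hmem] with ξ hξ
  by_contra! hcon
  refine hξ ⟨w ξ, ⟨?_, hcon⟩, rfl⟩
  by_contra hwK
  exact absurd (hKε hwK : dist (Φ (w ξ)) 0 < ε) (not_lt.2 hcon)

lemma continuousAt_of_antitone_rightInverse {v w : ℝ → ℝ} (hanti : Antitone v) {ξ : ℝ}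
    (hvw : ∀ᶠ x in 𝓝 ξ, v (w x) = x) (hleft : ∀ z < w ξ, ξ < v z) (hright : ∀ z > w ξ, v z < ξ) :
    ContinuousAt w ξ := by
  refine tendsto_order.2 ⟨fun a ha => ?_, fun b hb => ?_⟩
  · filter_upwards [hvw, eventually_lt_nhds (hleft a ha)] with x hx hxa
    by_contra! hcon
    linarith [hanti hcon]
  · filter_upwards [hvw, eventually_gt_nhds (hright b hb)] with x hx hxb
    by_contra! hcon
    linarith [hanti hcon]

theorem statement2
    (p : ℝ) (hp : 1 < p)
    (Θ : Set ℝ) (hΘfin : Θ.Finite) (hΘsub : Θ ⊆ Set.Ioo 0 1)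
    (f g h d : ℝ → ℝ)
    (hfb : ∃ M, ∀ x ∈ Set.Icc (0:ℝ) 1, |f x| ≤ M)
    (hgb : ∃ M, ∀ x ∈ Set.Icc (0:ℝ) 1, |g x| ≤ M)
    (hhb : ∃ M, ∀ x ∈ Set.Icc (0:ℝ) 1, |h x| ≤ M)
    (hfc : ∀ x ∈ Set.Icc (0:ℝ) 1 \ Θ, ContinuousWithinAt f (Set.Icc 0 1) x)
    (hgc : ∀ x ∈ Set.Icc (0:ℝ) 1 \ Θ, ContinuousWithinAt g (Set.Icc 0 1) x)
    (hhc : ∀ x ∈ Set.Icc (0:ℝ) 1 \ Θ, ContinuousWithinAt h (Set.Icc 0 1) x)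
    (hdc : ∀ x ∈ Set.Ioo (0:ℝ) 1 \ Θ, ContinuousWithinAt d (Set.Ioo 0 1) x)
    (hdbounds : ∀ a b : ℝ, 0 < a → a < b → b < 1 →
      (∃ m > 0, ∀ x ∈ Set.Icc a b, m ≤ d x) ∧ (∃ M, ∀ x ∈ Set.Icc a b, d x ≤ M))
    (hh0 : h 0 = 0) (hh1 : h 1 = 0)
    (hhpos : ∀ a b : ℝ, 0 < a → a < b → b < 1 → ∃ m > 0, ∀ x ∈ Set.Icc a b, m ≤ h x)
    (κ : ℝ → ℝ) (hκdef : ∀ ξ, κ ξ = d ξ ^ ((1:ℝ)/(p-1)) * h ξ)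
    (hκint : MeasureTheory.IntegrableOn κ (Set.Ioo 0 1))
    (c : ℝ) (v Φ : ℝ → ℝ)
    (hsol : IsTWSol p Θ f g h d c v Φ) :
    IsFOSol p Θ f g κ c (fun ξ => -Φ (Function.invFun v ξ)) := by
  obtain ⟨hv, hv01, hbot, htop, -, hΦ, -, hΦb, hΦt, hΦ0, heq⟩ := id hsol
  obtain ⟨Mf, hMf⟩ := hfb
  obtain ⟨Mg, hMg⟩ := hgb
  obtain ⟨Mh, hMh⟩ := hhb
  have hM : ∀ ξ ∈ Icc (0:ℝ) 1, |c * g ξ - f ξ| ≤ |c| * Mg + Mf := fun ξ hξ =>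
    calc |c * g ξ - f ξ| ≤ |c * g ξ| + |f ξ| := abs_sub _ _
      _ ≤ |c| * Mg + Mf := by
        rw [abs_mul]
        gcongr
        exacts [hMg ξ hξ, hMf ξ hξ]
  have hhv : Measurable fun z => h (v z) :=
    measurable_comp_of_continuous_off_finite hΘfin measurableSet_Icc hhc hv hv01
  have hint : ∀ a b : ℝ, IntervalIntegrable (fun z => h (v z)) volume a b :=
    intervalIntegrable_of_measurable_of_abs_le hhv fun z => hMh _ (hv01 z)
  have hhlow : ∀ ξ ∈ Ioo (0:ℝ) 1, ∃ m > 0, ∀ᶠ x in 𝓝 ξ, m ≤ h x := fun ξ hξ =>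
    pos_of_locally_bounded_below hhpos hξ
  have hdlow : ∀ ξ ∈ Ioo (0:ℝ) 1, ∃ m > 0, ∀ᶠ x in 𝓝 ξ, m ≤ d x := fun ξ hξ =>
    pos_of_locally_bounded_below (fun a b ha hab hb => (hdbounds a b ha hab hb).1) hξ
  have hhev : ∀ ξ ∈ Ioo (0:ℝ) 1, ∀ᶠ x in 𝓝 ξ, 0 < h x := fun ξ hξ => by
    obtain ⟨m, hm, hmh⟩ := hhlow ξ hξ
    exact hmh.mono fun x hx => hm.trans_le hx
  have hd0 : ∀ ξ ∈ Ioo (0:ℝ) 1, 0 < d ξ := fun ξ hξ => by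
    obtain ⟨m, hm, hmd⟩ := hdlow ξ hξ
    exact hm.trans_le hmd.self_of_nhds
  have hnn : ∀ z, 0 ≤ h (v z) := fun z => by
    rcases (hv01 z).1.eq_or_lt with h0 | h0
    · rw [← h0, hh0]
    rcases (hv01 z).2.eq_or_lt with h1 | h1
    · rw [h1, hh1]
    exact (hhev _ ⟨h0, h1⟩).self_of_nhds.le
  have hanti := hsol.antitone hΘfin hint hnn hhev hd0
  have hlt : ∀ a b : ℝ, a < b → v a ∈ Ioo (0:ℝ) 1 → v b < v a := fun a b hab hva =>
    hsol.lt_of_lt hanti hint hnn hhev hab hva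
  have hneg : ∀ z, v z ∈ Ioo (0:ℝ) 1 → Φ z < 0 := fun z hz =>
    hsol.flux_neg hp hΘfin hanti hlt hint hhlow hdlow hM hz
  set w := Function.invFun v
  have hvw : ∀ ξ ∈ Ioo (0:ℝ) 1, v (w ξ) = ξ := fun ξ hξ =>
    Function.invFun_eq (mem_range_of_exists_le_of_exists_ge hv
      ((htop.eventually_le_const hξ.1).exists) ((hbot.eventually_const_le hξ.2).exists))
  have hvw_ev : ∀ ξ ∈ Ioo (0:ℝ) 1, ∀ᶠ x in 𝓝 ξ, v (w x) = x := fun ξ hξ =>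
    eventually_of_mem (Ioo_mem_nhds hξ.1 hξ.2) hvw
  have hwc : ∀ ξ ∈ Ioo (0:ℝ) 1, ContinuousAt w ξ := fun ξ hξ => by
    have hvξ := hvw ξ hξ
    refine continuousAt_of_antitone_rightInverse hanti (hvw_ev ξ hξ) (fun z hz => ?_)
      fun z hz => ?_
    · refine lt_of_le_of_ne (hvξ ▸ hanti hz.le) fun hzξ => ?_
      exact (hlt z (w ξ) hz (hzξ ▸ hξ)).ne (hvξ.trans hzξ)
    · exact (hlt (w ξ) z hz (hvξ.symm ▸ hξ)).trans_eq hvξ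
  have hyc : ∀ ξ ∈ Ioo (0:ℝ) 1, ContinuousAt (fun ξ => -Φ (w ξ)) ξ := fun ξ hξ =>
    (hΦ.continuousAt.comp (hwc ξ hξ)).neg
  have hypos : ∀ ξ ∈ Ioo (0:ℝ) 1, 0 < -Φ (w ξ) := fun ξ hξ =>
    neg_pos.2 (hneg _ ((hvw ξ hξ).symm ▸ hξ))
  have hopen : IsOpen (Ioo (0:ℝ) 1 \ Θ) := isOpen_Ioo.sdiff hΘfin.isClosed
  have hFc : ∀ ξ ∈ Ioo (0:ℝ) 1 \ Θ, ContinuousAt (fun ξ => c * g ξ - f ξ) ξ := fun ξ hξ => by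
    have hnhds := Icc_mem_nhds hξ.1.1 hξ.1.2
    have hξ' : ξ ∈ Icc (0:ℝ) 1 \ Θ := ⟨Ioo_subset_Icc_self hξ.1, hξ.2⟩
    exact (continuousAt_const.mul ((hgc ξ hξ').continuousAt hnhds)).sub
      ((hfc ξ hξ').continuousAt hnhds)
  have hhcont : ∀ ξ ∈ Ioo (0:ℝ) 1 \ Θ, ContinuousAt h ξ := fun ξ hξ =>
    (hhc ξ ⟨Ioo_subset_Icc_self hξ.1, hξ.2⟩).continuousAt (Icc_mem_nhds hξ.1.1 hξ.1.2)
  have hderiv : ∀ ξ ∈ Ioo (0:ℝ) 1 \ Θ, HasDerivAt (fun ξ => -Φ (w ξ))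
      (c * g ξ - f ξ - κ ξ / (-Φ (w ξ)) ^ ((1:ℝ)/(p-1))) ξ := fun ξ hξ => by
    have hvξ := hvw ξ hξ.1
    have hgen : v (w ξ) ∉ Θ ∪ ({0, 1} : Set ℝ) := by
      simp [hvξ, hξ.2, hξ.1.1.ne', hξ.1.2.ne]
    obtain ⟨hv', hflux⟩ := hsol.hasDerivAt_and_flux_eq hΘfin hgen
    have hdξ := hd0 ξ hξ.1
    have hyξ := hypos ξ hξ.1
    rw [hvξ] at hflux
    have hv'neg : deriv v (w ξ) < 0 := by
      by_contra! hcon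
      have : 0 ≤ Φ (w ξ) := by
        rw [hflux]
        positivity
      linarith
    have hw' : HasDerivAt w (deriv v (w ξ))⁻¹ ξ :=
      HasDerivAt.of_local_left_inverse (hwc ξ hξ.1) hv' hv'neg.ne (hvw_ev ξ hξ.1)
    have h1 : HasDerivAt (fun x => ∫ s in ξ..x, (c * g s - f s)) (c * g ξ - f ξ) ξ :=
      intervalIntegral.integral_hasDerivAt_right IntervalIntegrable.refl
        (ContinuousOn.stronglyMeasurableAtFilter hopen
          (fun x hx => (hFc x hx).continuousWithinAt) ξ hξ) (hFc ξ hξ)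
    have h2 : HasDerivAt (fun x => ∫ s in (w ξ)..x, h (v s)) (h ξ) (w ξ) := by
      have hcont : ContinuousAt (fun s => h (v s)) (w ξ) :=
        ContinuousAt.comp (g := h) (hvξ.symm ▸ hhcont ξ hξ) hv.continuousAt
      have := intervalIntegral.integral_hasDerivAt_right (hint (w ξ) (w ξ))
        (hhv.stronglyMeasurable.stronglyMeasurableAtFilter) hcont
      rwa [hvξ] at this
    have h3 := (h1.add (HasDerivAt.comp ξ h2 hw')).const_add (-Φ (w ξ))
    have hval : c * g ξ - f ξ - κ ξ / (-Φ (w ξ)) ^ ((1:ℝ)/(p-1)) =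
        c * g ξ - f ξ + h ξ * (deriv v (w ξ))⁻¹ := by
      have hs : 0 < -deriv v (w ξ) := neg_pos.2 hv'neg
      have hp1 : p - 1 ≠ 0 := by linarith
      have hy : -Φ (w ξ) = d ξ * (-deriv v (w ξ)) ^ (p - 1) := by
        rw [hflux, abs_of_neg hv'neg, ← rpow_sub_two_mul_self hp hs.le]
        ring
      rw [hy, Real.mul_rpow hdξ.le (by positivity), ← Real.rpow_mul hs.le,
        mul_one_div_cancel hp1, Real.rpow_one, hκdef,
        mul_div_mul_left _ _ (Real.rpow_pos_of_pos hdξ _).ne', div_neg, sub_neg_eq_add,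
        div_eq_mul_inv]
    rw [hval]
    refine h3.congr_of_eventuallyEq ?_
    filter_upwards [hvw_ev ξ hξ.1] with x hx
    have := heq (w ξ) (w x)
    rw [hvξ, hx] at this
    simp only [Pi.add_apply, Function.comp_apply]
    linarith
  refine ⟨fun ξ hξ => (hyc ξ hξ).continuousWithinAt, ?_, hypos, ?_, ?_, hderiv⟩
  · rw [contDiffOn_one_iff_derivWithin hopen.uniqueDiffOn]
    refine ⟨fun ξ hξ => (hderiv ξ hξ).differentiableAt.differentiableWithinAt, ?_⟩
    refine ContinuousOn.congr (f := fun ξ => c * g ξ - f ξ - κ ξ / (-Φ (w ξ)) ^ ((1:ℝ)/(p-1)))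
      (fun ξ hξ => ContinuousAt.continuousWithinAt ?_)
      fun ξ hξ => (hderiv ξ hξ).hasDerivWithinAt.derivWithin (hopen.uniqueDiffOn ξ hξ)
    have hκc : ContinuousAt κ ξ := by
      rw [funext hκdef]
      exact (((hdc ξ hξ).continuousAt (Ioo_mem_nhds hξ.1.1 hξ.1.2)).rpow_const
        (Or.inl (hd0 ξ hξ.1).ne')).mul (hhcont ξ hξ)
    exact (hFc ξ hξ).sub (hκc.div ((hyc ξ hξ.1).rpow_const (Or.inl (hypos ξ hξ.1).ne'))
      (Real.rpow_pos_of_pos (hypos ξ hξ.1) _).ne')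
  · have hlim : Tendsto (fun ξ => v (w ξ)) (𝓝[>] 0) (𝓝 0) :=
      (tendsto_id.mono_left nhdsWithin_le_nhds).congr' <| by
        filter_upwards [Ioo_mem_nhdsGT one_pos] with ξ hξ using (hvw ξ hξ).symm
    simpa using (flux_comp_tendsto_zero hv hΦ hΦb hΦt (fun z hz => hΦ0 z (Or.inl hz)) hlim).neg
  · have hlim : Tendsto (fun ξ => v (w ξ)) (𝓝[<] 1) (𝓝 1) :=
      (tendsto_id.mono_left nhdsWithin_le_nhds).congr' <| by
        filter_upwards [Ioo_mem_nhdsLT one_pos] with ξ hξ using (hvw ξ hξ).symm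
    simpa using (flux_comp_tendsto_zero hv hΦ hΦb hΦt (fun z hz => hΦ0 z (Or.inr hz)) hlim).neg
end

section
/- Set ℓ_p := liminf_{ξ→0⁺} κ(ξ)^{p−1}/ξ and p′ := p/(p−1). If ℓ_p < +∞ and c ∈ ℝ satisfies c g(0) − f(0) < p′ [ℓ_p (p−1)]^{1/p}, then problem (1.4) admits no solution with wave speed c. -/
open Filter Set MeasureTheory Topology

/-- Weighted arithmetic-geometric mean inequality behind the threshold speed. -/
theorem threshold_le_add {p s b l : ℝ} (hp : 1 < p) (hs : 0 < s) (hb : 0 < b) (hl : 0 ≤ l)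
    (h : l ≤ s * b ^ (p - 1)) :
    p / (p - 1) * (l * (p - 1)) ^ ((1 : ℝ) / p) ≤ s + b := by
  have hp0 : 0 < p := by linarith
  have hp1 : 0 < p - 1 := by linarith
  set r := p / (p - 1) with hr
  have hr0 : 0 < r := by positivity
  have hpr : p = r * (p - 1) := by rw [hr]; field_simp
  have key := Real.geom_mean_le_arith_mean2_weighted (w₁ := 1 / p) (w₂ := (p - 1) / p)
    (p₁ := p * s) (p₂ := r * b) (by positivity) (by positivity) (by positivity) (by positivity)
    (by field_simp; ring)
  have h1 : 1 / p * (p * s) + (p - 1) / p * (r * b) = s + b := by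
    rw [hr]; field_simp
  rw [h1] at key
  refine le_trans ?_ key
  have h2 : (r * b) ^ ((p - 1) / p) = ((r * b) ^ (p - 1)) ^ (1 / p) := by
    rw [← Real.rpow_mul (by positivity)]; congr 1; ring
  have h3 : r = (r ^ p) ^ (1 / p) := by
    rw [← Real.rpow_mul hr0.le, mul_one_div_cancel hp0.ne', Real.rpow_one]
  rw [h2, ← Real.mul_rpow (by positivity) (by positivity)]
  nth_rewrite 1 [h3]
  rw [← Real.mul_rpow (by positivity) (by positivity)]
  refine Real.rpow_le_rpow (by positivity) ?_ (by positivity)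
  rw [Real.mul_rpow hr0.le hb.le]
  have h4 : r ^ p = r ^ (p - 1) * r := by
    rw [← Real.rpow_add_one hr0.ne']; congr 1; ring
  have h5 : p * s * (r ^ (p - 1) * b ^ (p - 1)) = r ^ p * (p - 1) * (s * b ^ (p - 1)) := by
    rw [h4]; nth_rewrite 1 [hpr]; ring
  rw [h5]
  have h6 := mul_le_mul_of_nonneg_left h (show 0 ≤ r ^ p * (p - 1) by positivity)
  linarith

/-- A function bounded and continuous off a finite set is integrable on the unit interval. -/
theorem integrableOn_unitInterval_of_continuous_off_finite {Θ : Set ℝ} (hΘ : Θ.Finite)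
    {q : ℝ → ℝ} {B : ℝ} (hB : ∀ x ∈ Icc (0 : ℝ) 1, |q x| ≤ B)
    (hq : ContinuousOn q (Icc 0 1 \ Θ)) : IntegrableOn q (Icc 0 1) := by
  have hmeas : MeasurableSet (Icc (0 : ℝ) 1 \ Θ) := measurableSet_Icc.diff hΘ.measurableSet
  have hae : (Icc (0 : ℝ) 1 \ Θ : Set ℝ) =ᵐ[volume] Icc (0 : ℝ) 1 :=
    sdiff_null_ae_eq_self (hΘ.measure_zero volume)
  refine IntegrableOn.congr_set_ae ?_ hae.symm
  refine IntegrableOn.of_bound ?_ (hq.aestronglyMeasurable hmeas) B ?_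
  · exact (measure_mono sdiff_subset).trans_lt measure_Icc_lt_top
  · exact (ae_restrict_iff' hmeas).2 (Eventually.of_forall fun x hx => hB x hx.1)

/-- The fundamental theorem of calculus at the lower endpoint of the integral. -/
theorem hasDerivAt_integral_self {u : ℝ → ℝ} {U : Set ℝ} {x : ℝ} (hU : IsOpen U)
    (hu : ContinuousOn u U) (hx : x ∈ U) : HasDerivAt (fun y => ∫ t in x..y, u t) (u x) x :=
  intervalIntegral.integral_hasDerivAt_right (by simp)
    (hu.stronglyMeasurableAtFilter hU x hx) (hu.continuousAt (hU.mem_nhds hx))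

section Profile

variable {p ε δ B : ℝ} {q h d v Φ : ℝ → ℝ}

/-- The flux plus the primitive of the convective term is nonnegative along a profile. -/
theorem profile_energy_nonneg (hv : ∀ z, v z ∈ Icc (0 : ℝ) 1) (hv0 : Tendsto v atTop (𝓝 0))
    (hΦ0 : Tendsto Φ atTop (𝓝 0)) (hqi : IntegrableOn q (Icc 0 1))
    (hqB : ∀ x ∈ Icc (0 : ℝ) 1, |q x| ≤ B) (hh : ∀ x ∈ Icc (0 : ℝ) 1, 0 ≤ h x)
    (hiv : ∀ z₁ z₂, Φ z₂ - Φ z₁ + (∫ ξ in (v z₁)..(v z₂), q ξ) + (∫ z in z₁..z₂, h (v z)) = 0)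
    (z : ℝ) : 0 ≤ Φ z + ∫ ξ in (0 : ℝ)..(v z), q ξ := by
  have hint : ∀ a ∈ Icc (0 : ℝ) 1, ∀ b ∈ Icc (0 : ℝ) 1, IntervalIntegrable q volume a b := by
    intro a ha b hb
    refine (hqi.mono_set ?_).intervalIntegrable
    exact uIcc_subset_Icc ha hb
  have h0 : (0 : ℝ) ∈ Icc (0 : ℝ) 1 := by simp
  have hbound : ∀ y ∈ Icc (0 : ℝ) 1, ‖∫ ξ in (0 : ℝ)..y, q ξ‖ ≤ B * |y - 0| := by
    intro y hy
    refine intervalIntegral.norm_integral_le_of_norm_le_const fun x hx => hqB x ?_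
    rw [uIoc_of_le hy.1] at hx
    exact ⟨hx.1.le, hx.2.trans hy.2⟩
  have hlim0 : Tendsto (fun y => ∫ ξ in (0 : ℝ)..(v y), q ξ) atTop (𝓝 0) := by
    refine squeeze_zero_norm (fun y => hbound (v y) (hv y)) ?_
    have := (hv0.sub_const 0).abs.const_mul B
    simpa using this
  have hlim : Tendsto (fun y => Φ y + ∫ ξ in (0 : ℝ)..(v y), q ξ) atTop (𝓝 0) := by
    simpa using hΦ0.add hlim0
  refine le_of_tendsto hlim ?_
  filter_upwards [eventually_ge_atTop z] with y hy
  have h1 : 0 ≤ ∫ t in z..y, h (v t) :=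
    intervalIntegral.integral_nonneg hy fun t _ => hh _ (hv t)
  have h2 := intervalIntegral.integral_add_adjacent_intervals (hint 0 h0 (v z) (hv z))
    (hint (v z) (hv z) (v y) (hv y))
  linarith [hiv z y]

/-- The derivative of the accumulated reaction term at a point of the low range. -/
theorem profile_hasDerivAt_reaction (hvc : Continuous v) (hhc : ContinuousOn h (Ioo 0 ε))
    {z : ℝ} (hz : v z ∈ Ioo 0 ε) :
    HasDerivAt (fun y => ∫ t in z..y, h (v t)) (h (v z)) z :=
  hasDerivAt_integral_self (U := v ⁻¹' Ioo 0 ε) (isOpen_Ioo.preimage hvc)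
    (hhc.comp hvc.continuousOn fun _ hx => hx) hz

/-- Once a profile reaches zero it stays there. -/
theorem profile_eq_zero_of_le (hε : 0 < ε) (hvc : Continuous v)
    (hv : ∀ z, v z ∈ Icc (0 : ℝ) 1) (hv0 : Tendsto v atTop (𝓝 0))
    (hΦ0 : Tendsto Φ atTop (𝓝 0)) (hqi : IntegrableOn q (Icc 0 1))
    (hqB : ∀ x ∈ Icc (0 : ℝ) 1, |q x| ≤ B) (hh : ∀ x ∈ Icc (0 : ℝ) 1, 0 ≤ h x)
    (hhpos : ∀ x ∈ Ioo 0 ε, 0 < h x) (hhc : ContinuousOn h (Ioo 0 ε))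
    (hΦz : ∀ z, v z = 0 → Φ z = 0)
    (hiv : ∀ z₁ z₂, Φ z₂ - Φ z₁ + (∫ ξ in (v z₁)..(v z₂), q ξ) + (∫ z in z₁..z₂, h (v z)) = 0)
    {a b : ℝ} (hab : a ≤ b) (ha : v a = 0) : v b = 0 := by
  by_contra hb
  have hbpos : 0 < v b := lt_of_le_of_ne (hv b).1 (Ne.symm hb)
  obtain ⟨y, hy0, hy⟩ := exists_between (lt_min hbpos hε)
  obtain ⟨z, hz, rfl⟩ : ∃ z ∈ Icc a b, v z = y :=
    intermediate_value_Icc hab hvc.continuousOn ⟨by rw [ha]; exact hy0.le,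
      (hy.trans_le (min_le_left _ _)).le⟩
  have hzε : v z ∈ Ioo 0 ε := ⟨hy0, hy.trans_le (min_le_right _ _)⟩
  have hE := profile_energy_nonneg hv hv0 hΦ0 hqi hqB hh hiv
  have haz : a < z := lt_of_le_of_ne hz.1 fun hc => by rw [← hc, ha] at hy0; exact lt_irrefl _ hy0
  have hE0 : ∀ x, a ≤ x → Φ x + ∫ ξ in (0 : ℝ)..(v x), q ξ = 0 := by
    intro x hx
    have h1 := hiv a x
    rw [ha, hΦz a ha] at h1
    have h2 : 0 ≤ ∫ t in a..x, h (v t) :=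
      intervalIntegral.integral_nonneg hx fun t _ => hh _ (hv t)
    linarith [hE x]
  have hint : ∀ s ∈ Icc (0 : ℝ) 1, ∀ t ∈ Icc (0 : ℝ) 1, IntervalIntegrable q volume s t :=
    fun s hs t ht => (hqi.mono_set (uIcc_subset_Icc hs ht)).intervalIntegrable
  have hconst : (fun y => ∫ t in z..y, h (v t)) =ᶠ[𝓝 z] fun _ => 0 := by
    filter_upwards [eventually_gt_nhds haz] with x hx
    have h2 := intervalIntegral.integral_add_adjacent_intervals
      (hint 0 (by simp) (v z) (hv z)) (hint (v z) (hv z) (v x) (hv x))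
    linarith [hiv z x, hE0 z haz.le, hE0 x hx.le]
  have h3 := (profile_hasDerivAt_reaction hvc hhc hzε).unique
    ((hasDerivAt_const z (0 : ℝ)).congr_of_eventuallyEq hconst)
  exact (hhpos _ hzε).ne' h3

/-- The flux satisfies the pointwise equation wherever the profile lies in the low range. -/
theorem profile_hasDerivAt_flux (hvc : Continuous v) (hqc : ContinuousOn q (Ioo 0 ε))
    (hhc : ContinuousOn h (Ioo 0 ε))
    (hiv : ∀ z₁ z₂, Φ z₂ - Φ z₁ + (∫ ξ in (v z₁)..(v z₂), q ξ) + (∫ z in z₁..z₂, h (v z)) = 0)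
    {z : ℝ} (hz : v z ∈ Ioo 0 ε) (hvd : DifferentiableAt ℝ v z) :
    HasDerivAt Φ (-(q (v z) * deriv v z) - h (v z)) z := by
  have h1 : HasDerivAt (fun y => ∫ t in (v z)..(v y), q t) (q (v z) * deriv v z) z :=
    (hasDerivAt_integral_self isOpen_Ioo hqc hz).comp z hvd.hasDerivAt
  have h2 := profile_hasDerivAt_reaction hvc hhc hz
  have h3 := (h1.neg.sub h2).const_add (Φ z)
  refine h3.congr_of_eventuallyEq (Eventually.of_forall fun y => ?_)
  simp only [Pi.neg_apply, Pi.sub_apply]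
  linarith [hiv z y]

/-- After the last point where a profile equals `ε`, as long as it is positive, its flux is
negative. -/
theorem profile_flux_neg (hvc : Continuous v) (hqc : ContinuousOn q (Ioo 0 ε))
    (hhpos : ∀ x ∈ Ioo 0 ε, 0 < h x) (hhc : ContinuousOn h (Ioo 0 ε))
    (hdpos : ∀ x ∈ Ioo 0 ε, 0 < d x)
    (hvd : ∀ z, v z ∈ Ioo 0 ε → DifferentiableAt ℝ v z)
    (hΦ : ∀ z, v z ∈ Ioo 0 ε → Φ z = d (v z) * |deriv v z| ^ (p - 2) * deriv v z)
    (hiv : ∀ z₁ z₂, Φ z₂ - Φ z₁ + (∫ ξ in (v z₁)..(v z₂), q ξ) + (∫ z in z₁..z₂, h (v z)) = 0)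
    {t z : ℝ} (htz : t < z) (ht : v t = ε) (hI : ∀ y ∈ Ioc t z, v y ∈ Ioo 0 ε) : Φ z < 0 := by
  have hzI : z ∈ Ioc t z := ⟨htz, le_rfl⟩
  obtain ⟨m, hm, hmin⟩ := isCompact_Icc.exists_isMinOn (nonempty_Icc.2 htz.le)
    (hvc.continuousOn (s := Icc t z))
  have hmt : t < m := by
    refine lt_of_le_of_ne hm.1 fun hc => ?_
    have : v m ≤ v z := hmin ⟨htz.le, le_rfl⟩
    rw [← hc, ht] at this
    exact absurd (hI z hzI).2 (not_lt.2 this)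
  have hmI := hI m ⟨hmt, hm.2⟩
  have hleft : ∀ᶠ y in 𝓝[<] m, v m ≤ v y := by
    filter_upwards [Ioo_mem_nhdsLT hmt] with y hy
    exact hmin ⟨hy.1.le, hy.2.le.trans hm.2⟩
  by_cases hd0 : deriv v m = 0
  · exfalso
    have hΦm : Φ m = 0 := by rw [hΦ m hmI, hd0, mul_zero]
    have hder := profile_hasDerivAt_flux hvc hqc hhc hiv hmI (hvd m hmI)
    rw [hd0, mul_zero, neg_zero, zero_sub] at hder
    have hpos : ∀ᶠ y in 𝓝[<] m, 0 < Φ y := by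
      have := (hasDerivAt_iff_tendsto_slope_left_right.1 hder).1.eventually_lt_const
        (neg_lt_zero.2 (hhpos _ hmI))
      filter_upwards [this, self_mem_nhdsWithin] with y hy hym
      rw [slope_def_field, hΦm] at hy
      have hym' : y < m := hym
      by_contra hle
      have : 0 ≤ (Φ y - 0) / (y - m) :=
        div_nonneg_of_nonpos (by linarith) (by linarith)
      linarith
    obtain ⟨a, ham, ha⟩ := (mem_nhdsLT_iff_exists_Ioo_subset' hmt).1
      (hpos.and (Ioo_mem_nhdsLT hmt))
    have hmono : StrictMonoOn v (Icc ((a + m) / 2) m) := by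
      refine strictMonoOn_of_deriv_pos (convex_Icc _ _) hvc.continuousOn fun y hy => ?_
      rw [interior_Icc] at hy
      have ham' : a < m := ham
      obtain ⟨hy1, hy2⟩ := ha (show y ∈ Ioo a m from ⟨by linarith [hy.1], hy.2⟩)
      have hyI := hI y ⟨hy2.1, hy2.2.le.trans hm.2⟩
      have hy1' : 0 < Φ y := hy1
      rw [hΦ y hyI] at hy1'
      exact pos_of_mul_pos_right hy1'
        (mul_nonneg (hdpos _ hyI).le (Real.rpow_nonneg (abs_nonneg _) _))
    have ham' : a < m := ham
    obtain ⟨hy1, hy2⟩ := ha (show (a + m) / 2 ∈ Ioo a m from ⟨by linarith, by linarith⟩)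
    have h1 := hmono ⟨le_rfl, by linarith⟩ ⟨by linarith, le_rfl⟩
      (show (a + m) / 2 < m by linarith)
    have h2 : v m ≤ v ((a + m) / 2) := hmin ⟨hy2.1.le, hy2.2.le.trans hm.2⟩
    linarith
  · have hmz : m = z := by
      by_contra hne
      have hlt : m < z := lt_of_le_of_ne hm.2 hne
      exact hd0 ((hmin.isLocalMin (Icc_mem_nhds hmt hlt)).deriv_eq_zero)
    subst hmz
    have hneg : deriv v m < 0 := by
      refine lt_of_le_of_ne ?_ hd0
      refine le_of_tendsto (hasDerivAt_iff_tendsto_slope_left_right.1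
        (hvd m hmI).hasDerivAt).1 ?_
      filter_upwards [hleft, self_mem_nhdsWithin] with y hy hym
      rw [slope_def_field]
      exact div_nonpos_of_nonneg_of_nonpos (by linarith) (by linarith [show y < m from hym])
    rw [hΦ m hmI]
    exact mul_neg_of_pos_of_neg
      (mul_pos (hdpos _ hmI) (Real.rpow_pos_of_pos (abs_pos.2 hd0) _)) hneg

/-- No profile exists below the threshold: the ratio of flux to profile would have to blow up
logarithmically although it is bounded. -/
theorem no_profile_of_barrier (hε : 0 < ε) (hε1 : ε < 1) (hδ : 0 < δ) (hvc : Continuous v)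
    (hv : ∀ z, v z ∈ Icc (0 : ℝ) 1) (hv1 : Tendsto v atBot (𝓝 1)) (hv0 : Tendsto v atTop (𝓝 0))
    (hΦ0 : Tendsto Φ atTop (𝓝 0)) (hqi : IntegrableOn q (Icc 0 1))
    (hqB : ∀ x ∈ Icc (0 : ℝ) 1, |q x| ≤ B) (hh : ∀ x ∈ Icc (0 : ℝ) 1, 0 ≤ h x)
    (hqc : ContinuousOn q (Ioo 0 ε))
    (hhpos : ∀ x ∈ Ioo 0 ε, 0 < h x) (hhc : ContinuousOn h (Ioo 0 ε))
    (hdpos : ∀ x ∈ Ioo 0 ε, 0 < d x)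
    (hvd : ∀ z, v z ∈ Ioo 0 ε → DifferentiableAt ℝ v z)
    (hΦ : ∀ z, v z ∈ Ioo 0 ε → Φ z = d (v z) * |deriv v z| ^ (p - 2) * deriv v z)
    (hΦz : ∀ z, v z = 0 → Φ z = 0)
    (hiv : ∀ z₁ z₂, Φ z₂ - Φ z₁ + (∫ ξ in (v z₁)..(v z₂), q ξ) + (∫ z in z₁..z₂, h (v z)) = 0)
    (hbar : ∀ ξ ∈ Ioo 0 ε, ∀ u > 0, q ξ + δ ≤ d ξ * u ^ (p - 1) / ξ + h ξ / u) : False := by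
  obtain ⟨t, ht, htlt⟩ : ∃ t, v t = ε ∧ ∀ z, t < z → v z < ε := by
    obtain ⟨a, ha⟩ := (hv1.eventually_const_lt hε1).exists
    obtain ⟨b, hb⟩ := eventually_atTop.1 (hv0.eventually_lt_const hε)
    have hne : {z | ε ≤ v z}.Nonempty := ⟨a, ha.le⟩
    have hbdd : BddAbove {z | ε ≤ v z} :=
      ⟨b, fun z hz => le_of_lt (by by_contra hc; exact absurd (hb z (not_lt.1 hc)) (not_lt.2 hz))⟩
    have hcl : IsClosed {z | ε ≤ v z} := isClosed_le continuous_const hvc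
    have hgt : ∀ z, sSup {z | ε ≤ v z} < z → v z < ε := fun z hz => by
      by_contra hc
      exact absurd (le_csSup hbdd (show z ∈ {z | ε ≤ v z} from not_lt.1 hc)) (not_le.2 hz)
    refine ⟨_, le_antisymm ?_ (hcl.csSup_mem hne hbdd), hgt⟩
    refine le_of_tendsto (hvc.continuousWithinAt (s := Ioi (sSup {z | ε ≤ v z}))) ?_
    filter_upwards [self_mem_nhdsWithin] with z hz
    exact (hgt z hz).le
  have hzero : ∀ {a b}, a ≤ b → v a = 0 → v b = 0 := fun hab ha =>
    profile_eq_zero_of_le hε hvc hv hv0 hΦ0 hqi hqB hh hhpos hhc hΦz hiv hab ha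
  have hI : ∀ z, t < z → 0 < v z → ∀ y ∈ Ioc t z, v y ∈ Ioo 0 ε := fun z _ hz y hy =>
    ⟨lt_of_le_of_ne (hv y).1 fun hc => hz.ne' (hzero hy.2 hc.symm), htlt y hy.1⟩
  have hneg : ∀ z, t < z → 0 < v z → Φ z < 0 := fun z htz hz =>
    profile_flux_neg hvc hqc hhpos hhc hdpos hvd hΦ hiv htz ht (hI z htz hz)
  have hbd : ∀ z, 0 < v z → -Φ z / v z ≤ B := by
    intro z hz
    have h1 := profile_energy_nonneg hv hv0 hΦ0 hqi hqB hh hiv z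
    have h2 : ‖∫ ξ in (0 : ℝ)..(v z), q ξ‖ ≤ B * |v z - 0| := by
      refine intervalIntegral.norm_integral_le_of_norm_le_const fun x hx => hqB x ?_
      rw [uIoc_of_le hz.le] at hx
      exact ⟨hx.1.le, hx.2.trans (hv z).2⟩
    rw [sub_zero, abs_of_pos hz, Real.norm_eq_abs] at h2
    rw [div_le_iff₀ hz]
    linarith [le_abs_self (∫ ξ in (0 : ℝ)..(v z), q ξ)]
  have hmono : ∀ a b, t < a → a ≤ b → 0 < v b →
      -Φ a / v a + δ * Real.log (v a) ≤ -Φ b / v b + δ * Real.log (v b) := by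
    intro a b hta hab hb
    have htb : t < b := hta.trans_le hab
    have hder : ∀ y ∈ Icc a b, HasDerivAt (fun y => -Φ y / v y + δ * Real.log (v y))
        ((-(-(q (v y) * deriv v y) - h (v y)) * v y - -Φ y * deriv v y) / v y ^ 2
          + δ * (deriv v y / v y)) y := by
      intro y hy
      have hyI := hI b htb hb y ⟨hta.trans_le hy.1, hy.2⟩
      exact ((profile_hasDerivAt_flux hvc hqc hhc hiv hyI (hvd y hyI)).fun_neg.fun_div
        (hvd y hyI).hasDerivAt hyI.1.ne').add
        (((hvd y hyI).hasDerivAt.log hyI.1.ne').const_mul δ)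
    refine monotoneOn_of_deriv_nonneg (convex_Icc a b)
      (fun y hy => (hder y hy).continuousAt.continuousWithinAt)
      (fun y hy => (hder y (interior_subset hy)).differentiableAt.differentiableWithinAt)
      ?_ ⟨le_rfl, hab⟩ ⟨hab, le_rfl⟩ hab
    intro y hy
    have hy' := interior_subset hy
    rw [(hder y hy').deriv]
    have hty := hta.trans_le hy'.1
    have hyI := hI b htb hb y ⟨hty, hy'.2⟩
    have hΦy := hneg y hty hyI.1
    have hu : deriv v y < 0 := by
      rw [hΦ y hyI] at hΦy
      by_contra hc
      have := mul_nonneg (mul_nonneg (hdpos _ hyI).le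
        (Real.rpow_nonneg (abs_nonneg (deriv v y)) (p - 2))) (not_lt.1 hc)
      linarith
    obtain ⟨u, hudef⟩ : ∃ u, deriv v y = -u := ⟨-deriv v y, by ring⟩
    have hupos : 0 < u := by linarith
    have hΦu : Φ y = -(d (v y) * u ^ (p - 1)) := by
      have : u ^ (p - 1) = u ^ (p - 2) * u := by
        rw [← Real.rpow_add_one hupos.ne']; congr 1; ring
      rw [hΦ y hyI, hudef, abs_neg, abs_of_pos hupos, this]; ring
    have hb1 := hbar (v y) hyI u hupos
    have hvy := hyI.1
    have heq : (-(-(q (v y) * deriv v y) - h (v y)) * v y - -Φ y * deriv v y) / v y ^ 2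
          + δ * (deriv v y / v y)
        = u / v y * (d (v y) * u ^ (p - 1) / v y + h (v y) / u - (q (v y) + δ)) := by
      rw [hΦu, hudef]; field_simp; ring
    rw [heq]
    exact mul_nonneg (by positivity) (by linarith)
  obtain ⟨a, hta, ha⟩ : ∃ a, t < a ∧ 0 < v a := by
    have : ∀ᶠ y in 𝓝[>] t, 0 < v y :=
      (hvc.tendsto t).mono_left nhdsWithin_le_nhds |>.eventually_const_lt (by rw [ht]; exact hε)
    obtain ⟨a, h1, h2⟩ := (this.and self_mem_nhdsWithin).exists
    exact ⟨a, h2, h1⟩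
  set C := -Φ a / v a + δ * Real.log (v a) with hC
  have hlog : ∀ᶠ y in 𝓝[>] (0 : ℝ), Real.log y < (C - B) / δ :=
    Real.tendsto_log_nhdsGT_zero.eventually_lt_atBot _
  obtain ⟨y, ⟨hylog, hya⟩, hy0⟩ := ((hlog.and ((eventually_lt_nhds ha).filter_mono
    nhdsWithin_le_nhds)).and self_mem_nhdsWithin).exists
  have hy0' : 0 < y := hy0
  obtain ⟨b, hby, hab⟩ := ((hv0.eventually_lt_const hy0').and (eventually_ge_atTop a)).exists
  obtain ⟨z, hz, rfl⟩ : ∃ z ∈ Icc a b, v z = y :=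
    intermediate_value_Icc' hab hvc.continuousOn ⟨hby.le, hya.le⟩
  have h1 := hmono a z hta hz.1 hy0'
  have h2 := hbd z hy0'
  rw [lt_div_iff₀ hδ] at hylog
  nlinarith

end Profile

/-- A nonnegative real lower bound for the quotient near zero that still lies above the speed. -/
theorem exists_eventual_lower_bound {F : ℝ → ℝ} {p r A : ℝ} (hp : 1 < p)
    (hF : ∀ᶠ ξ in 𝓝[>] (0 : ℝ), 0 ≤ F ξ)
    (htop : liminf (fun ξ => (F ξ : EReal)) (𝓝[>] (0 : ℝ)) < ⊤)
    (hA : A < r * ((liminf (fun ξ => (F ξ : EReal)) (𝓝[>] (0 : ℝ))).toReal * (p - 1))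
      ^ ((1 : ℝ) / p)) :
    ∃ l, 0 ≤ l ∧ A < r * (l * (p - 1)) ^ ((1 : ℝ) / p) ∧ ∀ᶠ ξ in 𝓝[>] (0 : ℝ), l ≤ F ξ := by
  set L := liminf (fun ξ => (F ξ : EReal)) (𝓝[>] (0 : ℝ)) with hL
  have hL0 : 0 ≤ L := le_liminf_of_le (by isBoundedDefault) (hF.mono fun ξ h => by exact_mod_cast h)
  have hcoe : (L.toReal : EReal) = L :=
    EReal.coe_toReal htop.ne (ne_of_gt (lt_of_lt_of_le EReal.bot_lt_zero hL0))
  rcases (EReal.toReal_nonneg hL0).eq_or_lt with h0 | hpos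
  · exact ⟨0, le_rfl, by rwa [← h0] at hA, hF⟩
  · have hcont : Continuous fun l : ℝ => r * (l * (p - 1)) ^ ((1 : ℝ) / p) :=
      continuous_const.mul ((continuous_id.mul continuous_const).rpow_const
        fun _ => Or.inr (by positivity))
    have h1 : ∀ᶠ l in 𝓝[<] L.toReal, A < r * (l * (p - 1)) ^ ((1 : ℝ) / p) :=
      ((hcont.tendsto _).mono_left nhdsWithin_le_nhds).eventually_const_lt hA
    obtain ⟨l, hl, hl'⟩ := (h1.and (Ioo_mem_nhdsLT hpos)).exists
    refine ⟨l, hl'.1.le, hl, ?_⟩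
    have hlt : (l : EReal) < L := by rw [← hcoe]; exact_mod_cast hl'.2
    filter_upwards [eventually_lt_of_lt_liminf hlt] with ξ hξ
    exact le_of_lt (by exact_mod_cast hξ)

theorem statement15
    (p : ℝ) (hp : 1 < p)
    (Θ : Set ℝ) (hΘfin : Θ.Finite) (hΘsub : Θ ⊆ Set.Ioo 0 1)
    (f g h d : ℝ → ℝ)
    (hfb : ∃ M, ∀ x ∈ Set.Icc (0:ℝ) 1, |f x| ≤ M)
    (hgb : ∃ M, ∀ x ∈ Set.Icc (0:ℝ) 1, |g x| ≤ M)
    (hhb : ∃ M, ∀ x ∈ Set.Icc (0:ℝ) 1, |h x| ≤ M)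
    (hfc : ∀ x ∈ Set.Icc (0:ℝ) 1 \ Θ, ContinuousWithinAt f (Set.Icc 0 1) x)
    (hgc : ∀ x ∈ Set.Icc (0:ℝ) 1 \ Θ, ContinuousWithinAt g (Set.Icc 0 1) x)
    (hhc : ∀ x ∈ Set.Icc (0:ℝ) 1 \ Θ, ContinuousWithinAt h (Set.Icc 0 1) x)
    (hdc : ∀ x ∈ Set.Ioo (0:ℝ) 1 \ Θ, ContinuousWithinAt d (Set.Ioo 0 1) x)
    (hdbounds : ∀ a b : ℝ, 0 < a → a < b → b < 1 →
      (∃ m > 0, ∀ x ∈ Set.Icc a b, m ≤ d x) ∧ (∃ M, ∀ x ∈ Set.Icc a b, d x ≤ M))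
    (hh0 : h 0 = 0) (hh1 : h 1 = 0)
    (hhpos : ∀ a b : ℝ, 0 < a → a < b → b < 1 → ∃ m > 0, ∀ x ∈ Set.Icc a b, m ≤ h x)
    (κ : ℝ → ℝ) (hκdef : ∀ ξ, κ ξ = d ξ ^ ((1:ℝ)/(p-1)) * h ξ)
    (hκint : MeasureTheory.IntegrableOn κ (Set.Ioo 0 1))
    (hΘ0 : (0:ℝ) ∉ Θ)
    (p' : ℝ) (hp' : p' = p / (p - 1))
    (lp : EReal)
    (hlp : lp = Filter.liminf (fun ξ : ℝ => ((κ ξ ^ (p - 1) / ξ : ℝ) : EReal))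
      (nhdsWithin 0 (Set.Ioi 0)))
    (hlpfin : lp < ⊤)
    (c : ℝ)
    (hc : c * g 0 - f 0 < p' * (lp.toReal * (p - 1)) ^ ((1:ℝ)/p)) :
    ¬ ∃ v Φ : ℝ → ℝ, IsTWSol p Θ f g h d c v Φ := by
  rintro ⟨v, Φ, hvc, hv, hv1, hv0, hCD, hΦc, hΦ, -, hΦ0, hΦz, hiv⟩
  subst hp' hlp
  have hp1 : 0 < p - 1 := by linarith
  have hpos : ∀ {u : ℝ → ℝ}, (∀ a b : ℝ, 0 < a → a < b → b < 1 →
      ∃ m > 0, ∀ x ∈ Icc a b, m ≤ u x) → ∀ x ∈ Ioo (0 : ℝ) 1, 0 < u x := by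
    intro u hu x hx
    obtain ⟨m, hm, hmx⟩ := hu (x / 2) ((x + 1) / 2) (by linarith [hx.1]) (by linarith [hx.1])
      (by linarith [hx.2])
    exact hm.trans_le (hmx x ⟨by linarith [hx.1], by linarith [hx.2]⟩)
  have hh' := hpos hhpos
  have hd' := hpos fun a b h1 h2 h3 => (hdbounds a b h1 h2 h3).1
  have hhnn : ∀ x ∈ Icc (0 : ℝ) 1, 0 ≤ h x := by
    intro x hx
    rcases hx.1.eq_or_lt with h0 | h0
    · rw [← h0, hh0]
    rcases hx.2.eq_or_lt with h1 | h1
    · rw [h1, hh1]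
    exact (hh' x ⟨h0, h1⟩).le
  have hκ : ∀ x ∈ Ioo (0 : ℝ) 1, κ x ^ (p - 1) = d x * h x ^ (p - 1) := by
    intro x hx
    rw [hκdef, Real.mul_rpow (Real.rpow_nonneg (hd' x hx).le _) (hh' x hx).le,
      ← Real.rpow_mul (hd' x hx).le, one_div_mul_cancel hp1.ne', Real.rpow_one]
  have h01 : ∀ᶠ ξ in 𝓝[>] (0 : ℝ), ξ ∈ Ioo (0 : ℝ) 1 := Ioo_mem_nhdsGT one_pos
  obtain ⟨l, hl0, hlA, hlκ⟩ := exists_eventual_lower_bound hp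
    (h01.mono fun ξ hξ => div_nonneg (by
      rw [hκ ξ hξ]
      exact mul_nonneg (hd' ξ hξ).le (Real.rpow_nonneg (hh' ξ hξ).le _)) hξ.1.le) hlpfin hc
  obtain ⟨A, hA, hA'⟩ := exists_between hlA
  have h0mem : (0 : ℝ) ∈ Icc (0 : ℝ) 1 \ Θ := ⟨by simp, hΘ0⟩
  have hqc : ∀ x ∈ Icc (0 : ℝ) 1 \ Θ,
      ContinuousWithinAt (fun x => c * g x - f x) (Icc 0 1) x := fun x hx =>
    ((hgc x hx).const_mul c).sub (hfc x hx)
  have hqA : ∀ᶠ ξ in 𝓝[>] (0 : ℝ), c * g ξ - f ξ < A := by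
    have h1 : ∀ᶠ ξ in 𝓝[Icc 0 1] (0 : ℝ), c * g ξ - f ξ < A :=
      (hqc 0 h0mem).eventually_lt_const hA
    have h2 : 𝓝[>] (0 : ℝ) ≤ 𝓝[Icc 0 1] 0 :=
      nhdsWithin_le_of_mem (mem_of_superset (Ioo_mem_nhdsGT one_pos) Ioo_subset_Icc_self)
    exact h1.filter_mono h2
  have hΘev : ∀ᶠ ξ in 𝓝[>] (0 : ℝ), ξ ∉ Θ :=
    mem_nhdsWithin_of_mem_nhds (hΘfin.isClosed.isOpen_compl.mem_nhds hΘ0)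
  obtain ⟨e, he, hsub⟩ := (mem_nhdsGT_iff_exists_Ioo_subset' (one_pos (α := ℝ))).1
    (hlκ.and (hqA.and hΘev))
  obtain ⟨ε, hε, hεlt⟩ := exists_between (lt_min (show (0 : ℝ) < e from he) one_pos)
  have hε1 : ε < 1 := hεlt.trans_le (min_le_right _ _)
  have hlow : ∀ x ∈ Ioo 0 ε, l ≤ κ x ^ (p - 1) / x ∧ c * g x - f x < A ∧ x ∉ Θ := fun x hx =>
    hsub ⟨hx.1, hx.2.trans (hεlt.trans_le (min_le_left _ _))⟩
  have hlow1 : Ioo 0 ε ⊆ Ioo (0 : ℝ) 1 := Ioo_subset_Ioo_right hε1.le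
  have hcont : ∀ {u : ℝ → ℝ}, (∀ x ∈ Icc (0 : ℝ) 1 \ Θ, ContinuousWithinAt u (Icc 0 1) x) →
      ContinuousOn u (Ioo 0 ε) := fun hu x hx =>
    (hu x ⟨Ioo_subset_Icc_self (hlow1 hx), (hlow x hx).2.2⟩).mono
      (hlow1.trans Ioo_subset_Icc_self)
  obtain ⟨Mf, hMf⟩ := hfb
  obtain ⟨Mg, hMg⟩ := hgb
  have hqB : ∀ x ∈ Icc (0 : ℝ) 1, |c * g x - f x| ≤ |c| * Mg + Mf := fun x hx =>
    (abs_sub _ _).trans (add_le_add (by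
      rw [abs_mul]
      exact mul_le_mul_of_nonneg_left (hMg x hx) (abs_nonneg c)) (hMf x hx))
  have hqi := integrableOn_unitInterval_of_continuous_off_finite hΘfin hqB
    fun x hx => (hqc x hx).mono sdiff_subset
  have hlocal : ∀ z, v z ∈ Ioo 0 ε → DifferentiableAt ℝ v z ∧
      Φ z = d (v z) * |deriv v z| ^ (p - 2) * deriv v z := by
    intro z hz
    obtain ⟨a, b, hzab, hab⟩ := mem_nhds_iff_exists_Ioo_subset.1
      ((isOpen_Ioo.preimage hvc).mem_nhds (show z ∈ v ⁻¹' Ioo 0 ε from hz))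
    have hCD' : ContDiffOn ℝ 1 v (Ioo a b) := by
      refine hCD.mono fun y hy => ?_
      have hy' := hab hy
      rintro (h1 | h1 | h1)
      · exact (hlow _ hy').2.2 h1
      · exact hy'.1.ne' h1
      · exact (hlow1 hy').2.ne h1
    exact ⟨(hCD'.contDiffAt (Ioo_mem_nhds hzab.1 hzab.2)).differentiableAt one_ne_zero,
      hΦ a b (hzab.1.trans hzab.2) hCD' (fun y hy => hlow1 (hab hy)) z hzab⟩
  refine no_profile_of_barrier hε hε1 (sub_pos.2 hA') hvc hv hv1 hv0 hΦ0 hqi hqB hhnn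
    (hcont hqc) (fun x hx => hh' x (hlow1 hx)) (hcont hhc) (fun x hx => hd' x (hlow1 hx))
    (fun z hz => (hlocal z hz).1) (fun z hz => (hlocal z hz).2) (fun z hz => hΦz z (Or.inl hz))
    hiv fun ξ hξ u hu => ?_
  have hdξ := hd' ξ (hlow1 hξ)
  have hhξ := hh' ξ (hlow1 hξ)
  have hξ0 := hξ.1
  have hle : l ≤ d ξ * u ^ (p - 1) / ξ * (h ξ / u) ^ (p - 1) := by
    refine (hlow ξ hξ).1.trans_eq ?_
    have hu' : 0 < u ^ (p - 1) := Real.rpow_pos_of_pos hu _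
    rw [hκ ξ (hlow1 hξ), Real.div_rpow hhξ.le hu.le]
    field_simp
  have hthr := threshold_le_add hp (by positivity) (by positivity) hl0 hle
  linarith [(hlow ξ hξ).2.1]
end
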